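/- Let σ > 5/2. For every smooth divergence-free vector field b on 𝕋³ and every smooth ℝ²-valued function V on 𝕋³ with 𝒫V = V, one has the identity ⟨Λ^{2σ}V, 𝒫(b·∇V)⟩ = ⟨Λ^σV, [Λ^σ, b·∇]V⟩, and consequently there exists a constant C = C(σ) > 0 such that |⟨Λ^{2σ}V, 𝒫(b·∇V)⟩| ≤ C ‖b‖_{H^{σ+2}} ‖V‖²_{H^σ}. -/

import Mathlib

/-!
We model functions on the torus `𝕋³ = ℝ³/ℤ³` by their Fourier coefficients,
indexed by `n ∈ ℤ³` (the actual frequency being `k = 2πn ∈ 2πℤ³`).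
Smoothness corresponds to rapid decay of the Fourier coefficients, real-valuedness
to the usual conjugation symmetry, products to convolution of coefficients, and
the `L²` norm/inner product are given by Plancherel.
-/

noncomputable section

open scoped BigOperators
open Complex

/-- Fourier frequencies of functions on `𝕋³`, indexed by `n ∈ ℤ³`; the actual
frequency is `k = 2πn ∈ 2πℤ³`. -/
abbrev Z3 : Type := Fin 3 → ℤ

/-- The Euclidean length `|k|` of the frequency `k = 2πn`. -/
def knorm (n : Z3) : ℝ := 2 * Real.pi * Real.sqrt (∑ i, ((n i : ℝ)) ^ 2)

/-- `Λ^s = (−Δ)^{s/2}` as a Fourier multiplier: `(Λ^s f)^_k = |k|^s f^_k`. -/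
def lam (s : ℝ) (c : Z3 → ℂ) : Z3 → ℂ :=
  fun n => Complex.ofReal (knorm n ^ s) * c n

/-- Squared `L²(𝕋³)` norm (Plancherel). -/
def l2sq (c : Z3 → ℂ) : ℝ := ∑' n : Z3, ‖c n‖ ^ 2

/-- `L²(𝕋³)` norm. -/
def l2norm (c : Z3 → ℂ) : ℝ := Real.sqrt (l2sq c)

/-- `L²(𝕋³)` inner product of two real-valued functions (Plancherel). -/
def inner2 (c d : Z3 → ℂ) : ℝ := (∑' n : Z3, c n * (starRingEnd ℂ) (d n)).re

/-- Sobolev `H^σ` norm: `(∑_k (1+|k|^{2σ})|f^_k|²)^{1/2}`. -/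
def hnorm (σ : ℝ) (c : Z3 → ℂ) : ℝ :=
  Real.sqrt (∑' n : Z3, (1 + knorm n ^ (2 * σ)) * ‖c n‖ ^ 2)

/-- The partial derivative `∂_j` as a Fourier multiplier. -/
def pd (j : Fin 3) (c : Z3 → ℂ) : Z3 → ℂ :=
  fun n => Complex.I * Complex.ofReal (2 * Real.pi * (n j : ℝ)) * c n

/-- Pointwise product of two functions = convolution of Fourier coefficients. -/
def conv (c d : Z3 → ℂ) : Z3 → ℂ := fun n => ∑' m : Z3, c m * d (n - m)

/-- The coefficients of a real-valued function. -/
def IsRealFn (c : Z3 → ℂ) : Prop := ∀ n : Z3, c (-n) = (starRingEnd ℂ) (c n)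

/-- Rapid decay of the Fourier coefficients, i.e. smoothness of the function. -/
def RapidDecay (c : Z3 → ℂ) : Prop :=
  ∀ N : ℕ, ∃ C : ℝ, ∀ n : Z3, ‖c n‖ * (1 + knorm n) ^ N ≤ C

/-- A smooth real-valued function on `𝕋³`, described by its Fourier coefficients. -/
def SmoothFun (c : Z3 → ℂ) : Prop := IsRealFn c ∧ RapidDecay c

/-- Zero mean. -/
def ZeroMean (c : Z3 → ℂ) : Prop := c 0 = 0

/-- A divergence-free vector field `b = (b¹,b²,b³)`: `∀ k, ∑_j k_j b^j_k = 0`. -/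
def DivFree (b : Fin 3 → Z3 → ℂ) : Prop :=
  ∀ n : Z3, ∑ j : Fin 3, (n j : ℂ) * b j n = 0

/-- The transport operator `b·∇ = b¹∂_{x₁} + b²∂_{x₂} + b³∂_z`. -/
def transport (b : Fin 3 → Z3 → ℂ) (c : Z3 → ℂ) : Z3 → ℂ :=
  fun n => ∑ j : Fin 3, conv (b j) (pd j c) n

/-- The commutator `[Λ^s, b·∇]`. -/
def commLam (s : ℝ) (b : Fin 3 → Z3 → ℂ) (c : Z3 → ℂ) : Z3 → ℂ :=
  lam s (transport b c) - transport b (lam s c)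

/-- `H^σ` norm of a 3-component vector field. -/
def hnormV3 (σ : ℝ) (b : Fin 3 → Z3 → ℂ) : ℝ :=
  Real.sqrt (∑ j : Fin 3, (hnorm σ (b j)) ^ 2)

/-- `Λ^s` acting componentwise on ℝ²-valued functions. -/
def lamV (s : ℝ) (V : Fin 2 → Z3 → ℂ) : Fin 2 → Z3 → ℂ := fun i => lam s (V i)

/-- `b·∇` acting componentwise on ℝ²-valued functions. -/
def transportV (b : Fin 3 → Z3 → ℂ) (V : Fin 2 → Z3 → ℂ) : Fin 2 → Z3 → ℂ :=
  fun i => transport b (V i)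

/-- `[Λ^s, b·∇]` acting componentwise on ℝ²-valued functions. -/
def commLamV (s : ℝ) (b : Fin 3 → Z3 → ℂ) (V : Fin 2 → Z3 → ℂ) : Fin 2 → Z3 → ℂ :=
  fun i => commLam s b (V i)

/-- `L²` norm of an ℝ²-valued function. -/
def l2normV (V : Fin 2 → Z3 → ℂ) : ℝ := Real.sqrt (∑ i : Fin 2, l2sq (V i))

/-- `L²` inner product of ℝ²-valued functions. -/
def inner2V (V W : Fin 2 → Z3 → ℂ) : ℝ := ∑ i : Fin 2, inner2 (V i) (W i)

/-- `H^σ` norm of an ℝ²-valued function. -/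
def hnormV2 (σ : ℝ) (V : Fin 2 → Z3 → ℂ) : ℝ :=
  Real.sqrt (∑ i : Fin 2, (hnorm σ (V i)) ^ 2)

/-- The hydrostatic Leray projection `𝒫φ = φ − ∇_h Δ_h^{-1} ∇_h · φ̄` as a Fourier
multiplier: the barotropic part `φ̄` consists of the modes with `n₃ = 0`, on which
`∇_h Δ_h^{-1} ∇_h ·` acts as `φ̂ ↦ n_h (n_h · φ̂)/|n_h|²` (for `n_h ≠ 0`). -/
def hproj (V : Fin 2 → Z3 → ℂ) : Fin 2 → Z3 → ℂ := fun i n =>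
  if n 2 = 0 ∧ ¬(n 0 = 0 ∧ n 1 = 0) then
    V i n - (n i.castSucc : ℂ) * ((n 0 : ℂ) * V 0 n + (n 1 : ℂ) * V 1 n) /
      (((n 0 : ℂ)) ^ 2 + ((n 1 : ℂ)) ^ 2)
  else V i n

/-- `ℚ = I − 𝒫`. -/
def qproj (V : Fin 2 → Z3 → ℂ) : Fin 2 → Z3 → ℂ := fun i => V i - hproj V i

/-- The commutator `[𝒫, b·∇]` on ℝ²-valued functions. -/
def commProj (b : Fin 3 → Z3 → ℂ) (V : Fin 2 → Z3 → ℂ) : Fin 2 → Z3 → ℂ :=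
  fun i => hproj (transportV b V) i - transportV b (hproj V) i

/-- A smooth ℝ²-valued function on `𝕋³`. -/
def SmoothV2 (V : Fin 2 → Z3 → ℂ) : Prop := ∀ i, SmoothFun (V i)

/-- A smooth vector field on `𝕋³`. -/
def SmoothV3 (b : Fin 3 → Z3 → ℂ) : Prop := ∀ j, SmoothFun (b j)

/-- `∂_z b^h = ∂_z (b¹, b²)`. -/
def dzbh (b : Fin 3 → Z3 → ℂ) : Fin 2 → Z3 → ℂ := fun i => pd 2 (b i.castSucc)

/-- `𝒫B V = 𝒫(b·∇V)`. -/
def PB (b : Fin 3 → Z3 → ℂ) (V : Fin 2 → Z3 → ℂ) : Fin 2 → Z3 → ℂ :=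
  hproj (transportV b V)

/-! ### Elementary facts about `knorm` -/

/-- The frequency as a Euclidean vector. -/
def evec (n : Z3) : EuclideanSpace ℝ (Fin 3) := WithLp.toLp 2 (fun i => (n i : ℝ))

lemma evec_add (m n : Z3) : evec (m + n) = evec m + evec n := by
  ext i; simp [evec]

lemma knorm_eq (n : Z3) : knorm n = 2 * Real.pi * ‖evec n‖ := by
  simp [knorm, evec, EuclideanSpace.norm_eq]

lemma knorm_nonneg (n : Z3) : 0 ≤ knorm n := by
  rw [knorm_eq]; positivity

lemma knorm_add_le (m n : Z3) : knorm (m + n) ≤ knorm m + knorm n := by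
  rw [knorm_eq, knorm_eq, knorm_eq, evec_add, ← mul_add]
  gcongr
  exact norm_add_le _ _

lemma knorm_neg (n : Z3) : knorm (-n) = knorm n := by
  simp [knorm]

lemma knorm_zero : knorm 0 = 0 := by simp [knorm]

lemma abs_coord_le (n : Z3) (j : Fin 3) : |(n j : ℝ)| ≤ ‖evec n‖ := by
  have := PiLp.norm_apply_le (evec n) j
  simpa [evec] using this

lemma coord_le_knorm (n : Z3) (j : Fin 3) : 2 * Real.pi * |(n j : ℝ)| ≤ knorm n := by
  rw [knorm_eq]
  have := abs_coord_le n j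
  gcongr

lemma one_le_evec {n : Z3} (hn : n ≠ 0) : 1 ≤ ‖evec n‖ := by
  obtain ⟨j, hj⟩ : ∃ j, n j ≠ 0 := by
    by_contra! h
    exact hn (funext h)
  refine le_trans ?_ (abs_coord_le n j)
  exact_mod_cast Int.one_le_abs hj

lemma evec_le_knorm (n : Z3) : ‖evec n‖ ≤ knorm n := by
  rw [knorm_eq]
  have := Real.pi_gt_three
  have h := norm_nonneg (evec n)
  nlinarith

lemma one_le_knorm {n : Z3} (hn : n ≠ 0) : 1 ≤ knorm n :=
  (one_le_evec hn).trans (evec_le_knorm n)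

lemma evec_injective : Function.Injective evec := by
  intro m n h
  funext i
  have := congrArg (fun v : EuclideanSpace ℝ (Fin 3) => v i) h
  simpa [evec] using this

lemma summable_weight : Summable (fun n : Z3 => ((1 + knorm n) ^ 4)⁻¹) := by
  let bb := (EuclideanSpace.basisFun (Fin 3) ℝ).toBasis
  let L : Submodule ℤ (EuclideanSpace ℝ (Fin 3)) := Submodule.span ℤ (Set.range bb)
  have hrank : Module.finrank ℤ L = 3 := by
    rw [ZLattice.rank ℝ L]; simp
  have hs : Summable fun z : L => ‖z‖⁻¹ ^ 4 :=
    ZLattice.summable_norm_pow_inv L 4 (by rw [hrank]; norm_num)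
  have hmem : ∀ n : Z3, evec n ∈ L := by
    intro n
    have : evec n = ∑ i, (n i) • bb i := by
      ext j
      simp [evec, bb, Pi.single_apply]
    rw [this]
    exact Submodule.sum_mem _ fun i _ => Submodule.smul_mem _ _
      (Submodule.subset_span ⟨i, rfl⟩)
  have h1 : Summable fun n : Z3 => ‖evec n‖⁻¹ ^ 4 := by
    have := hs.comp_injective (i := fun n : Z3 => (⟨evec n, hmem n⟩ : L))
      (fun m n h => evec_injective (congrArg Subtype.val h))
    exact this
  have h2 : Summable fun n : Z3 => ‖evec n‖⁻¹ ^ 4 + (if n = 0 then (1 : ℝ) else 0) := by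
    refine h1.add ?_
    exact (hasSum_ite_eq (0 : Z3) (1 : ℝ)).summable
  refine Summable.of_nonneg_of_le (fun n => ?_) (fun n => ?_) h2
  · have := knorm_nonneg n
    positivity
  · by_cases hn : n = 0
    · subst hn
      simp [knorm_zero, evec]
    · simp only [hn, if_false, add_zero, inv_pow]
      have h3 := one_le_evec hn
      have h4 := evec_le_knorm n
      gcongr
      linarith

/-! ### Rapid decay -/

lemma RapidDecay.lam {c : Z3 → ℂ} (hc : RapidDecay c) {s : ℝ} (hs : 0 ≤ s) :
    RapidDecay (lam s c) := by
  intro N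
  obtain ⟨C, hC⟩ := hc (N + ⌈s⌉₊)
  refine ⟨C, fun n => le_trans ?_ (hC n)⟩
  have h0 := knorm_nonneg n
  have h1 : knorm n ^ s ≤ (1 + knorm n) ^ ⌈s⌉₊ := by
    calc knorm n ^ s ≤ (1 + knorm n) ^ s := by
          apply Real.rpow_le_rpow h0 (by linarith) hs
      _ ≤ (1 + knorm n) ^ ((⌈s⌉₊ : ℕ) : ℝ) := by
          apply Real.rpow_le_rpow_of_exponent_le (by linarith) (Nat.le_ceil s)
      _ = _ := Real.rpow_natCast _ _
  have h2 : ‖_root_.lam s c n‖ = knorm n ^ s * ‖c n‖ := by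
    simp [_root_.lam, abs_of_nonneg (Real.rpow_nonneg h0 s)]
  rw [h2, pow_add]
  have h3 : 0 ≤ ‖c n‖ * (1 + knorm n) ^ N := by positivity
  nlinarith

lemma norm_pd (j : Fin 3) (c : Z3 → ℂ) (n : Z3) :
    ‖pd j c n‖ = 2 * Real.pi * |(n j : ℝ)| * ‖c n‖ := by
  simp [pd, abs_of_pos Real.pi_pos]

lemma RapidDecay.pd {c : Z3 → ℂ} (hc : RapidDecay c) (j : Fin 3) :
    RapidDecay (pd j c) := by
  intro N
  obtain ⟨C, hC⟩ := hc (N + 1)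
  refine ⟨C, fun n => le_trans ?_ (hC n)⟩
  rw [norm_pd, pow_succ]
  have h1 := coord_le_knorm n j
  have h0 := knorm_nonneg n
  have h3 : 0 ≤ ‖c n‖ * (1 + knorm n) ^ N := by positivity
  nlinarith

lemma RapidDecay.summable {c : Z3 → ℂ} (hc : RapidDecay c) : Summable (fun n => ‖c n‖) := by
  obtain ⟨C, hC⟩ := hc 4
  refine Summable.of_nonneg_of_le (fun n => norm_nonneg _) (fun n => ?_)
    (summable_weight.mul_left C)
  have h0 := knorm_nonneg n
  rw [← div_eq_mul_inv, le_div_iff₀ (by positivity)]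
  exact hC n

lemma RapidDecay.bounded {c : Z3 → ℂ} (hc : RapidDecay c) : ∃ C, 0 ≤ C ∧ ∀ n, ‖c n‖ ≤ C := by
  obtain ⟨C, hC⟩ := hc 0
  have : ∀ n, ‖c n‖ ≤ C := fun n => by simpa using hC n
  exact ⟨C, (norm_nonneg _).trans (this 0), this⟩

lemma norm_lam (s : ℝ) (c : Z3 → ℂ) (n : Z3) : ‖lam s c n‖ = knorm n ^ s * ‖c n‖ := by
  simp [lam, abs_of_nonneg (Real.rpow_nonneg (knorm_nonneg n) s)]

lemma RapidDecay.summable_sq {c : Z3 → ℂ} (hc : RapidDecay c) :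
    Summable (fun n => ‖c n‖ ^ 2) := by
  obtain ⟨C, hC0, hC⟩ := hc.bounded
  refine Summable.of_nonneg_of_le (fun n => by positivity) (fun n => ?_)
    (hc.summable.mul_left C)
  rw [sq]
  exact mul_le_mul_of_nonneg_right (hC n) (norm_nonneg _)

/-! ### The pointwise commutator bound -/

lemma rpow_sub_le {σ a b : ℝ} (hσ : 1 ≤ σ) (hb : 0 ≤ b) (hab : b ≤ a) :
    a ^ σ - b ^ σ ≤ σ * (a - b) * a ^ (σ - 1) := by
  rcases eq_or_lt_of_le (hb.trans hab) with h | h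
  · have : b = 0 := by linarith
    subst this
    simp [← h]
  · have h1 := one_add_mul_self_le_rpow_one_add (s := b / a - 1) (p := σ)
      (by have := div_nonneg hb h.le; linarith) hσ
    have h2 : (1 + (b / a - 1)) ^ σ = b ^ σ / a ^ σ := by
      rw [add_sub_cancel, Real.div_rpow hb h.le]
    rw [h2, le_div_iff₀ (Real.rpow_pos_of_pos h σ)] at h1
    have h3 : a ^ σ = a ^ (σ - 1) * a := by
      rw [← Real.rpow_add_one h.ne', sub_add_cancel]
    have h4 : (1 + σ * (b / a - 1)) * a ^ σ = a ^ σ + σ * (b - a) * a ^ (σ - 1) := by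
      rw [h3]; field_simp
    linarith

lemma abs_rpow_sub_le {σ a b M : ℝ} (hσ : 1 ≤ σ) (ha : 0 ≤ a) (hb : 0 ≤ b)
    (haM : a ≤ M) (hbM : b ≤ M) :
    |a ^ σ - b ^ σ| ≤ σ * |a - b| * M ^ (σ - 1) := by
  wlog hab : b ≤ a generalizing a b
  · rw [abs_sub_comm, abs_sub_comm a b]
    exact this hb ha hbM haM (le_of_not_ge hab)
  rw [abs_of_nonneg (sub_nonneg.2 (Real.rpow_le_rpow hb hab (by linarith))),
    abs_of_nonneg (sub_nonneg.2 hab)]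
  refine (rpow_sub_le hσ hb hab).trans ?_
  have := sub_nonneg.2 hab
  gcongr

lemma symbol_bound {σ : ℝ} (hσ : 1 ≤ σ) (m p : Z3) :
    |knorm (m + p) ^ σ - knorm p ^ σ| * knorm p ≤
      (σ * 2 ^ (σ - 1)) * (knorm m ^ σ * knorm p ^ σ) := by
  have hm0 := knorm_nonneg m
  have hp0 := knorm_nonneg p
  have hr : 0 ≤ (σ * 2 ^ (σ - 1)) * (knorm m ^ σ * knorm p ^ σ) := by positivity
  by_cases hp : p = 0
  · subst hp; simpa [knorm_zero] using hr
  by_cases hm : m = 0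
  · subst hm; simpa [knorm_zero] using hr
  have h1m := one_le_knorm hm
  have h1p := one_le_knorm hp
  have ht := knorm_add_le m p
  have ht2 : knorm p ≤ knorm (m + p) + knorm m := by
    have := knorm_add_le (m + p) (-m)
    rwa [knorm_neg, add_neg_cancel_comm] at this
  have hM : knorm m + knorm p ≤ 2 * (knorm m * knorm p) := by nlinarith
  have h := abs_rpow_sub_le (σ := σ) (a := knorm (m + p)) (b := knorm p)
    (M := 2 * (knorm m * knorm p)) hσ (knorm_nonneg _) hp0 (by linarith) (by linarith)
  have habs : |knorm (m + p) - knorm p| ≤ knorm m := by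
    rw [abs_le]; constructor <;> linarith
  have e1 : knorm m ^ σ = knorm m ^ (σ - 1) * knorm m := by
    rw [← Real.rpow_add_one (by linarith), sub_add_cancel]
  have e2 : knorm p ^ σ = knorm p ^ (σ - 1) * knorm p := by
    rw [← Real.rpow_add_one (by linarith), sub_add_cancel]
  have e3 : (2 * (knorm m * knorm p)) ^ (σ - 1) =
      2 ^ (σ - 1) * (knorm m ^ (σ - 1) * knorm p ^ (σ - 1)) := by
    rw [Real.mul_rpow (by norm_num) (by positivity), Real.mul_rpow hm0 hp0]
  calc |knorm (m + p) ^ σ - knorm p ^ σ| * knorm p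
      ≤ (σ * knorm m * (2 * (knorm m * knorm p)) ^ (σ - 1)) * knorm p := by
        refine mul_le_mul_of_nonneg_right (h.trans ?_) hp0
        gcongr
    _ = _ := by rw [e1, e2, e3]; ring

/-! ### Double sums -/

/-- The change of variables `(n, m) ↦ (n - m, m)`. -/
def shearEquiv : Z3 × Z3 ≃ Z3 × Z3 where
  toFun q := (q.1 - q.2, q.2)
  invFun q := (q.1 + q.2, q.2)
  left_inv q := by simp
  right_inv q := by simp

/-- The involution `(n, m) ↦ (n - m, -m)`. -/
def flipEquiv : Z3 × Z3 ≃ Z3 × Z3 where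
  toFun q := (q.1 - q.2, -q.2)
  invFun q := (q.1 - q.2, -q.2)
  left_inv q := by simp
  right_inv q := by simp

lemma hasSum_prod_aux {B k : Z3 → ℝ} (hB : Summable B) (hk : Summable k)
    (hB0 : ∀ n, 0 ≤ B n) (hk0 : ∀ n, 0 ≤ k n) :
    HasSum (fun q : Z3 × Z3 => B q.2 * k q.1) ((∑' n, B n) * ∑' n, k n) := by
  have h : Summable (fun q : Z3 × Z3 => k q.1 * B q.2) := hk.mul_of_nonneg hB hk0 hB0
  have := hk.hasSum.mul hB.hasSum h
  simpa [mul_comm] using this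

lemma hasSum_shear_aux {B k : Z3 → ℝ} (hB : Summable B) (hk : Summable k)
    (hB0 : ∀ n, 0 ≤ B n) (hk0 : ∀ n, 0 ≤ k n) :
    HasSum (fun q : Z3 × Z3 => B q.2 * k (q.1 - q.2)) ((∑' n, B n) * ∑' n, k n) :=
  (shearEquiv.hasSum_iff (f := fun q : Z3 × Z3 => B q.2 * k q.1)).2
    (hasSum_prod_aux hB hk hB0 hk0)

/-- Summand of the pairing `⟨u, b·∇ w⟩`. -/
def pairTerm (b : Fin 3 → Z3 → ℂ) (u w : Z3 → ℂ) (q : Z3 × Z3) : ℂ :=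
  u q.1 * (starRingEnd ℂ) (∑ j, b j q.2 * pd j w (q.1 - q.2))

lemma conv_summable {c d : Z3 → ℂ} (hc : RapidDecay c) (hd : RapidDecay d) (n : Z3) :
    Summable (fun m => c m * d (n - m)) := by
  obtain ⟨D, hD0, hD⟩ := hd.bounded
  refine Summable.of_norm_bounded (hc.summable.mul_right D) fun m => ?_
  rw [norm_mul]
  exact mul_le_mul_of_nonneg_left (hD _) (norm_nonneg _)

lemma transport_eq {b : Fin 3 → Z3 → ℂ} {w : Z3 → ℂ} (hb : ∀ j, RapidDecay (b j))
    (hw : RapidDecay w) (n : Z3) :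
    transport b w n = ∑' m, ∑ j, b j m * pd j w (n - m) := by
  rw [Summable.tsum_finsetSum fun j _ => conv_summable (hb j) (hw.pd j) n]
  rfl

lemma transport_bounded {b : Fin 3 → Z3 → ℂ} {w : Z3 → ℂ} (hb : ∀ j, RapidDecay (b j))
    (hw : RapidDecay w) : ∃ C, 0 ≤ C ∧ ∀ n, ‖transport b w n‖ ≤ C := by
  have : ∀ j, ∃ C, 0 ≤ C ∧ ∀ n, ‖conv (b j) (pd j w) n‖ ≤ C := by
    intro j
    obtain ⟨D, hD0, hD⟩ := (hw.pd j).bounded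
    refine ⟨(∑' m, ‖b j m‖) * D, mul_nonneg (tsum_nonneg fun _ => norm_nonneg _) hD0,
      fun n => ?_⟩
    refine tsum_of_norm_bounded ((hb j).summable.hasSum.mul_right D) fun m => ?_
    rw [norm_mul]
    exact mul_le_mul_of_nonneg_left (hD _) (norm_nonneg _)
  choose C hC0 hC using this
  refine ⟨∑ j, C j, Finset.sum_nonneg fun j _ => hC0 j, fun n => ?_⟩
  exact (norm_sum_le _ _).trans (Finset.sum_le_sum fun j _ => hC j n)

lemma pairTerm_summable {b : Fin 3 → Z3 → ℂ} {u w : Z3 → ℂ} (hb : ∀ j, RapidDecay (b j))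
    (hu : RapidDecay u) (hw : RapidDecay w) : Summable (pairTerm b u w) := by
  obtain ⟨D, hD0, hD⟩ := hu.bounded
  have h : Summable fun q : Z3 × Z3 => D * ∑ j, ‖b j q.2‖ * ‖pd j w (q.1 - q.2)‖ := by
    refine Summable.mul_left D (summable_sum fun j _ => ?_)
    exact (hasSum_shear_aux (hb j).summable (hw.pd j).summable (fun _ => norm_nonneg _)
      (fun _ => norm_nonneg _)).summable
  refine Summable.of_norm_bounded h fun q => ?_
  unfold pairTerm
  rw [norm_mul, RCLike.norm_conj]
  refine mul_le_mul (hD _) ?_ (norm_nonneg _) hD0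
  refine (norm_sum_le _ _).trans (Finset.sum_le_sum fun j _ => ?_)
  rw [norm_mul]

lemma tsum_pair {b : Fin 3 → Z3 → ℂ} {u w : Z3 → ℂ} (hb : ∀ j, RapidDecay (b j))
    (hu : RapidDecay u) (hw : RapidDecay w) :
    ∑' n, u n * (starRingEnd ℂ) (transport b w n) = ∑' q, pairTerm b u w q := by
  rw [(pairTerm_summable hb hu hw).tsum_prod]
  refine tsum_congr fun n => ?_
  rw [transport_eq hb hw, Complex.conj_tsum, ← tsum_mul_left]
  rfl

lemma pairTerm_flip {b : Fin 3 → Z3 → ℂ} {u : Z3 → ℂ} (hb : ∀ j, IsRealFn (b j))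
    (hdiv : DivFree b) (q : Z3 × Z3) :
    pairTerm b u u (flipEquiv q) = -(starRingEnd ℂ) (pairTerm b u u q) := by
  obtain ⟨n, m⟩ := q
  have hd := hdiv m
  have e0 := hb 0 m
  have e1 := hb 1 m
  have e2 := hb 2 m
  simp only [Fin.sum_univ_three] at hd
  simp only [pairTerm, flipEquiv, Equiv.coe_fn_mk, Fin.sum_univ_three, pd, sub_neg_eq_add,
    sub_add_cancel, map_add, map_mul, Complex.conj_conj, Complex.conj_I, Complex.conj_ofReal,
    e0, e1, e2, Pi.sub_apply, Pi.neg_apply, map_neg, neg_neg]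
  push_cast
  linear_combination (-Complex.I * 2 * Real.pi * (starRingEnd ℂ) (u n) * u (n - m)) * hd

lemma inner2_transport_self {b : Fin 3 → Z3 → ℂ} {u : Z3 → ℂ} (hb : SmoothV3 b)
    (hdiv : DivFree b) (hu : RapidDecay u) : inner2 u (transport b u) = 0 := by
  unfold inner2
  rw [tsum_pair (fun j => (hb j).2) hu hu]
  have h := flipEquiv.tsum_eq (pairTerm b u u)
  simp_rw [pairTerm_flip (fun j => (hb j).1) hdiv] at h
  rw [tsum_neg, ← Complex.conj_tsum] at h
  have := congrArg Complex.re h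
  simp only [Complex.neg_re, Complex.conj_re] at this
  linarith

/-! ### The projection -/

lemma summable_mul_conj {c d : Z3 → ℂ} (hc : RapidDecay c) (hd : ∃ C, 0 ≤ C ∧ ∀ n, ‖d n‖ ≤ C) :
    Summable (fun n => c n * (starRingEnd ℂ) (d n)) := by
  obtain ⟨D, hD0, hD⟩ := hd
  refine Summable.of_norm_bounded (hc.summable.mul_right D) fun m => ?_
  rw [norm_mul, RCLike.norm_conj]
  exact mul_le_mul_of_nonneg_left (hD _) (norm_nonneg _)

lemma hproj_bounded {W : Fin 2 → Z3 → ℂ} (hW : ∀ i, ∃ C, 0 ≤ C ∧ ∀ n, ‖W i n‖ ≤ C) (i : Fin 2) :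
    ∃ C, 0 ≤ C ∧ ∀ n, ‖hproj W i n‖ ≤ C := by
  choose C hC0 hC using hW
  refine ⟨C i + (C 0 + C 1), by have := hC0 i; have := hC0 0; have := hC0 1; linarith,
    fun n => ?_⟩
  unfold hproj
  split_ifs with h
  · refine (norm_sub_le _ _).trans (add_le_add (hC i n) ?_)
    have hpos : (0 : ℝ) < (n 0 : ℝ) ^ 2 + (n 1 : ℝ) ^ 2 := by
      have h' := h.2
      by_contra hcon
      apply h'
      have h0 : (n 0 : ℝ) = 0 := by nlinarith [sq_nonneg (n 0 : ℝ), sq_nonneg (n 1 : ℝ)]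
      have h1 : (n 1 : ℝ) = 0 := by nlinarith [sq_nonneg (n 0 : ℝ), sq_nonneg (n 1 : ℝ)]
      exact ⟨by exact_mod_cast h0, by exact_mod_cast h1⟩
    have hden : ‖((n 0 : ℂ)) ^ 2 + ((n 1 : ℂ)) ^ 2‖ = (n 0 : ℝ) ^ 2 + (n 1 : ℝ) ^ 2 := by
      have : ((n 0 : ℂ)) ^ 2 + ((n 1 : ℂ)) ^ 2 = (((n 0 : ℝ) ^ 2 + (n 1 : ℝ) ^ 2 : ℝ) : ℂ) := by
        push_cast; ring
      rw [this, Complex.norm_real, Real.norm_of_nonneg hpos.le]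
    rw [norm_div, hden, div_le_iff₀ hpos, norm_mul]
    have hn : ∀ k : ℤ, ‖(k : ℂ)‖ = |(k : ℝ)| := fun k => by simp
    have hsum : ‖(n 0 : ℂ) * W 0 n + (n 1 : ℂ) * W 1 n‖ ≤ |(n 0 : ℝ)| * C 0 + |(n 1 : ℝ)| * C 1 := by
      refine (norm_add_le _ _).trans ?_
      rw [norm_mul, norm_mul, hn, hn]
      have := hC 0 n
      have := hC 1 n
      gcongr
    have key : ∀ x y : ℝ, 0 ≤ x → 0 ≤ y → (x = |(n 0 : ℝ)| ∨ x = |(n 1 : ℝ)|) →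
        (y = |(n 0 : ℝ)| ∨ y = |(n 1 : ℝ)|) → x * y ≤ (n 0 : ℝ) ^ 2 + (n 1 : ℝ) ^ 2 := by
      intro x y _ _ hx hy
      have s0 := sq_abs (n 0 : ℝ)
      have s1 := sq_abs (n 1 : ℝ)
      rcases hx with rfl | rfl <;> rcases hy with rfl | rfl <;>
        nlinarith [sq_nonneg (|(n 0 : ℝ)| - |(n 1 : ℝ)|), sq_nonneg |(n 0 : ℝ)|,
          sq_nonneg |(n 1 : ℝ)|]
    have hx : |(n i.castSucc : ℝ)| = |(n 0 : ℝ)| ∨ |(n i.castSucc : ℝ)| = |(n 1 : ℝ)| := by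
      fin_cases i
      · left; rfl
      · right; rfl
    have k0 := key _ _ (abs_nonneg _) (abs_nonneg _) hx (Or.inl rfl)
    have k1 := key _ _ (abs_nonneg _) (abs_nonneg _) hx (Or.inr rfl)
    rw [hn]
    calc _ ≤ |(n i.castSucc : ℝ)| * (|(n 0 : ℝ)| * C 0 + |(n 1 : ℝ)| * C 1) := by gcongr
      _ = (|(n i.castSucc : ℝ)| * |(n 0 : ℝ)|) * C 0
          + (|(n i.castSucc : ℝ)| * |(n 1 : ℝ)|) * C 1 := by ring
      _ ≤ ((n 0 : ℝ) ^ 2 + (n 1 : ℝ) ^ 2) * C 0 + ((n 0 : ℝ) ^ 2 + (n 1 : ℝ) ^ 2) * C 1 :=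
          add_le_add (mul_le_mul_of_nonneg_right k0 (hC0 0))
            (mul_le_mul_of_nonneg_right k1 (hC0 1))
      _ = _ := by ring
  · have := hC i n
    have := hC0 0
    have := hC0 1
    linarith

lemma hproj_pointwise {V : Fin 2 → Z3 → ℂ} (hV : hproj V = V) (W : Fin 2 → Z3 → ℂ) (n : Z3)
    (r : ℂ) :
    r * V 0 n * (starRingEnd ℂ) (hproj W 0 n) + r * V 1 n * (starRingEnd ℂ) (hproj W 1 n) =
      r * V 0 n * (starRingEnd ℂ) (W 0 n) + r * V 1 n * (starRingEnd ℂ) (W 1 n) := by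
  by_cases h : n 2 = 0 ∧ ¬(n 0 = 0 ∧ n 1 = 0)
  · have hpos : ((n 0 : ℂ)) ^ 2 + ((n 1 : ℂ)) ^ 2 ≠ 0 := by
      have hz : (n 0) ^ 2 + (n 1) ^ 2 ≠ 0 := by
        intro hcon
        apply h.2
        constructor <;> nlinarith [sq_nonneg (n 0), sq_nonneg (n 1)]
      exact_mod_cast hz
    have h0 := congrFun (congrFun hV 0) n
    have h1 := congrFun (congrFun hV 1) n
    have c0 : (Fin.castSucc (0 : Fin 2)) = (0 : Fin 3) := rfl
    have c1 : (Fin.castSucc (1 : Fin 2)) = (1 : Fin 3) := rfl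
    simp only [hproj, h, not_false_eq_true, and_self, if_true, sub_eq_self, div_eq_zero_iff,
      hpos, or_false, c0, c1] at h0 h1
    have hdot : (n 0 : ℂ) * V 0 n + (n 1 : ℂ) * V 1 n = 0 := by
      by_contra hne
      have a0 := (mul_eq_zero.1 h0).resolve_right hne
      have a1 := (mul_eq_zero.1 h1).resolve_right hne
      exact hpos (by rw [a0, a1]; ring)
    simp only [hproj, h, not_false_eq_true, and_self, if_true, c0, c1, map_sub, map_mul,
      map_div₀, map_add, map_pow, map_intCast]
    linear_combination (-r * ((n 0 : ℂ) * (starRingEnd ℂ) (W 0 n) +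
      (n 1 : ℂ) * (starRingEnd ℂ) (W 1 n)) / (((n 0 : ℂ)) ^ 2 + ((n 1 : ℂ)) ^ 2)) * hdot
  · simp only [hproj, if_neg h]

lemma inner2V_hproj {V W : Fin 2 → Z3 → ℂ} {s : ℝ} (hs : 0 ≤ s) (hV : ∀ i, RapidDecay (V i))
    (hVp : hproj V = V) (hW : ∀ i, ∃ C, 0 ≤ C ∧ ∀ n, ‖W i n‖ ≤ C) :
    inner2V (lamV s V) (hproj W) = inner2V (lamV s V) W := by
  unfold inner2V inner2 lamV
  simp only [Fin.sum_univ_two]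
  rw [← Complex.add_re, ← Complex.add_re,
    ← (summable_mul_conj ((hV 0).lam hs) (hproj_bounded hW 0)).tsum_add
      (summable_mul_conj ((hV 1).lam hs) (hproj_bounded hW 1)),
    ← (summable_mul_conj ((hV 0).lam hs) (hW 0)).tsum_add
      (summable_mul_conj ((hV 1).lam hs) (hW 1))]
  congr 1
  exact tsum_congr fun n => hproj_pointwise hVp W n _

lemma rpow_two_mul' (n : Z3) (s : ℝ) : knorm n ^ (2 * s) = knorm n ^ s * knorm n ^ s := by
  rw [mul_comm, Real.rpow_mul (knorm_nonneg n)]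
  norm_num [sq]

lemma lam_pair (s : ℝ) (c d : Z3 → ℂ) (n : Z3) :
    lam (2 * s) c n * (starRingEnd ℂ) (d n) = lam s c n * (starRingEnd ℂ) (lam s d n) := by
  simp only [lam, rpow_two_mul', map_mul, Complex.conj_ofReal]
  push_cast
  ring

lemma inner2_comm {b : Fin 3 → Z3 → ℂ} {c : Z3 → ℂ} {s : ℝ} (hs : 0 ≤ s) (hb : SmoothV3 b)
    (hdiv : DivFree b) (hc : RapidDecay c) :
    inner2 (lam (2 * s) c) (transport b c) = inner2 (lam s c) (commLam s b c) := by
  have hb' := fun j => (hb j).2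
  have h0 := inner2_transport_self hb hdiv (hc.lam hs)
  have s1 := summable_mul_conj (hc.lam (s := 2 * s) (by linarith)) (transport_bounded hb' hc)
  have s2 := summable_mul_conj (hc.lam hs) (transport_bounded hb' (hc.lam hs))
  unfold inner2 at h0 ⊢
  have : ∀ n, lam s c n * (starRingEnd ℂ) (commLam s b c n) =
      lam (2 * s) c n * (starRingEnd ℂ) (transport b c n) -
        lam s c n * (starRingEnd ℂ) (transport b (lam s c) n) := by
    intro n
    rw [lam_pair]
    simp only [commLam, Pi.sub_apply, map_sub]
    ring
  simp_rw [this]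
  rw [s1.tsum_sub s2, Complex.sub_re, h0, sub_zero]

theorem identity_part {σ : ℝ} (hσ : 0 ≤ σ) {b : Fin 3 → Z3 → ℂ} (hb : SmoothV3 b)
    (hdiv : DivFree b) {V : Fin 2 → Z3 → ℂ} (hV : SmoothV2 V) (hVp : hproj V = V) :
    inner2V (lamV (2 * σ) V) (hproj (transportV b V)) =
      inner2V (lamV σ V) (commLamV σ b V) := by
  rw [inner2V_hproj (W := transportV b V) (by linarith) (fun i => (hV i).2) hVp
    (fun i => transport_bounded (fun j => (hb j).2) (hV i).2)]
  exact Finset.sum_congr rfl fun i _ => inner2_comm hσ hb hdiv (hV i).2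

/-! ### The estimate -/

lemma comm_eq {b : Fin 3 → Z3 → ℂ} {c : Z3 → ℂ} {s : ℝ} (hs : 0 ≤ s)
    (hb : ∀ j, RapidDecay (b j)) (hc : RapidDecay c) (n : Z3) :
    commLam s b c n = ∑' m, ∑ j, ((knorm n ^ s - knorm (n - m) ^ s : ℝ) : ℂ) *
      (b j m * pd j c (n - m)) := by
  have e1 : ∀ m, ∑ j, ((knorm n ^ s - knorm (n - m) ^ s : ℝ) : ℂ) * (b j m * pd j c (n - m)) =
      ((knorm n ^ s : ℝ) : ℂ) * (∑ j, b j m * pd j c (n - m)) -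
        ∑ j, b j m * pd j (lam s c) (n - m) := by
    intro m
    rw [Finset.mul_sum, ← Finset.sum_sub_distrib]
    refine Finset.sum_congr rfl fun j _ => ?_
    simp only [pd, lam]
    push_cast
    ring
  simp_rw [e1]
  rw [Summable.tsum_sub, tsum_mul_left, ← transport_eq hb hc, ← transport_eq hb (hc.lam hs)]
  · rfl
  · exact Summable.mul_left _ (summable_sum fun j _ => conv_summable (hb j) (hc.pd j) n)
  · exact summable_sum fun j _ => conv_summable (hb j) ((hc.lam hs).pd j) n

lemma term_bound {b : Fin 3 → Z3 → ℂ} {c : Z3 → ℂ} {s : ℝ} (hs : 1 ≤ s) (n m : Z3) :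
    ‖∑ j, ((knorm n ^ s - knorm (n - m) ^ s : ℝ) : ℂ) * (b j m * pd j c (n - m))‖ ≤
      (s * 2 ^ (s - 1)) * ((∑ j, ‖lam s (b j) m‖) * ‖lam s c (n - m)‖) := by
  refine (norm_sum_le _ _).trans ?_
  rw [Finset.sum_mul, Finset.mul_sum]
  refine Finset.sum_le_sum fun j _ => ?_
  rw [norm_mul, norm_mul, norm_pd, Complex.norm_real, Real.norm_eq_abs, norm_lam, norm_lam]
  have h1 := coord_le_knorm (n - m) j
  have h2 := symbol_bound hs m (n - m)
  rw [add_sub_cancel] at h2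
  calc _ ≤ |knorm n ^ s - knorm (n - m) ^ s| * (‖b j m‖ * (knorm (n - m) * ‖c (n - m)‖)) := by
        gcongr
    _ = (|knorm n ^ s - knorm (n - m) ^ s| * knorm (n - m)) * (‖b j m‖ * ‖c (n - m)‖) := by ring
    _ ≤ _ := mul_le_mul_of_nonneg_right h2 (by positivity)
    _ = _ := by ring

lemma inner2_comm_bound {b : Fin 3 → Z3 → ℂ} {c : Z3 → ℂ} {s : ℝ} (hs : 1 ≤ s)
    (hb : ∀ j, RapidDecay (b j)) (hc : RapidDecay c) :
    |inner2 (lam s c) (commLam s b c)| ≤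
      (s * 2 ^ (s - 1)) * ((∑' m, ∑ j, ‖lam s (b j) m‖) * ∑' n, ‖lam s c n‖ ^ 2) := by
  have hs0 : 0 ≤ s := by linarith
  set K := s * 2 ^ (s - 1) with hK
  have hK0 : 0 ≤ K := by positivity
  set B : Z3 → ℝ := fun m => ∑ j, ‖lam s (b j) m‖ with hBdef
  set g : Z3 → ℝ := fun n => ‖lam s c n‖ with hgdef
  have hB : Summable B := summable_sum fun j _ => ((hb j).lam hs0).summable
  have hB0 : ∀ m, 0 ≤ B m := fun m => Finset.sum_nonneg fun j _ => norm_nonneg _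
  have hg : Summable g := (hc.lam hs0).summable
  have hg0 : ∀ m, 0 ≤ g m := fun m => norm_nonneg _
  have hg2 : Summable fun n => g n ^ 2 := (hc.lam hs0).summable_sq
  have hP1 := hasSum_prod_aux hB hg2 hB0 (fun n => sq_nonneg _)
  have hP2 := hasSum_shear_aux hB hg2 hB0 (fun n => sq_nonneg _)
  have hP : HasSum (fun q : Z3 × Z3 =>
      2⁻¹ * (B q.2 * g q.1 ^ 2 + B q.2 * g (q.1 - q.2) ^ 2)) ((∑' n, B n) * ∑' n, g n ^ 2) := by
    have := (hP1.add hP2).mul_left 2⁻¹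
    rwa [← two_mul, inv_mul_cancel_left₀ (by norm_num)] at this
  have hle : ∀ q : Z3 × Z3, g q.1 * (B q.2 * g (q.1 - q.2)) ≤
      2⁻¹ * (B q.2 * g q.1 ^ 2 + B q.2 * g (q.1 - q.2) ^ 2) := by
    intro q
    nlinarith [mul_nonneg (hB0 q.2) (sq_nonneg (g q.1 - g (q.1 - q.2)))]
  have hQ : Summable (fun q : Z3 × Z3 => g q.1 * (B q.2 * g (q.1 - q.2))) :=
    Summable.of_nonneg_of_le
      (fun q => mul_nonneg (hg0 _) (mul_nonneg (hB0 _) (hg0 _))) hle hP.summable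
  have hQle : ∑' q : Z3 × Z3, g q.1 * (B q.2 * g (q.1 - q.2)) ≤ (∑' n, B n) * ∑' n, g n ^ 2 := by
    rw [← hP.tsum_eq]
    exact hQ.tsum_le_tsum hle hP.summable
  have hin : ∀ n, Summable fun m => B m * g (n - m) := fun n =>
    (hasSum_shear_aux hB hg hB0 hg0).summable.comp_injective (i := fun m => (n, m))
      (fun a a' h => congrArg Prod.snd h)
  have hcomm : ∀ n, ‖commLam s b c n‖ ≤ K * ∑' m, B m * g (n - m) := by
    intro n
    rw [comm_eq hs0 hb hc]
    exact tsum_of_norm_bounded ((hin n).hasSum.mul_left K) fun m => term_bound hs n m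
  unfold inner2
  refine (Complex.abs_re_le_norm _).trans ?_
  have hout : Summable fun n => g n * ∑' m, B m * g (n - m) := by
    have := hQ.prod
    simpa only [tsum_mul_left] using this
  have houtsum : ∑' n, g n * ∑' m, B m * g (n - m) =
      ∑' q : Z3 × Z3, g q.1 * (B q.2 * g (q.1 - q.2)) := by
    rw [hQ.tsum_prod]
    simp only [tsum_mul_left]
  refine (tsum_of_norm_bounded (hout.hasSum.mul_left K) fun n => ?_).trans
    (mul_le_mul_of_nonneg_left (houtsum.le.trans hQle) hK0)
  rw [norm_mul, RCLike.norm_conj]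
  calc _ ≤ g n * (K * ∑' m, B m * g (n - m)) := mul_le_mul_of_nonneg_left (hcomm n) (hg0 n)
    _ = _ := by ring

lemma summable_hnorm {c : Z3 → ℂ} (hc : RapidDecay c) {s : ℝ} (hs : 0 ≤ s) :
    Summable fun n => (1 + knorm n ^ (2 * s)) * ‖c n‖ ^ 2 := by
  refine (hc.summable_sq.add (hc.lam hs).summable_sq).congr fun n => ?_
  rw [norm_lam, rpow_two_mul']
  ring

lemma hnorm_sq {c : Z3 → ℂ} (s : ℝ) :
    hnorm s c ^ 2 = ∑' n, (1 + knorm n ^ (2 * s)) * ‖c n‖ ^ 2 :=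
  Real.sq_sqrt (tsum_nonneg fun n => by
    have := Real.rpow_nonneg (knorm_nonneg n) (2 * s)
    positivity)

lemma tsum_lam_sq_le {c : Z3 → ℂ} (hc : RapidDecay c) {s : ℝ} (hs : 0 ≤ s) :
    ∑' n, ‖lam s c n‖ ^ 2 ≤ hnorm s c ^ 2 := by
  rw [hnorm_sq]
  refine (hc.lam hs).summable_sq.tsum_le_tsum (fun n => ?_) (summable_hnorm hc hs)
  rw [norm_lam, rpow_two_mul']
  nlinarith [sq_nonneg ‖c n‖]

lemma weight_bound {s : ℝ} (hs : 0 < s) (n : Z3) :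
    knorm n ^ s * (1 + knorm n) ^ 2 ≤ 4 * knorm n ^ (s + 2) := by
  by_cases hn : n = 0
  · subst hn
    simp [knorm_zero, Real.zero_rpow hs.ne', Real.zero_rpow (by linarith : s + 2 ≠ 0)]
  · have h1 := one_le_knorm hn
    rw [Real.rpow_add (by linarith)]
    have : knorm n ^ (2 : ℝ) = knorm n ^ 2 := by norm_cast
    rw [this]
    have h2 : (1 + knorm n) ^ 2 ≤ 4 * knorm n ^ 2 := by nlinarith
    have h3 := Real.rpow_nonneg (knorm_nonneg n) s
    nlinarith

lemma tsum_lam_le {c : Z3 → ℂ} (hc : RapidDecay c) {s : ℝ} (hs : 0 < s) :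
    ∑' n, ‖lam s c n‖ ≤
      (4 * Real.sqrt (∑' n : Z3, ((1 + knorm n) ^ 4)⁻¹)) * hnorm (s + 2) c := by
  refine (hc.lam hs.le).summable.tsum_le_of_sum_le fun F => ?_
  have hk := knorm_nonneg
  have e : ∀ n, ‖lam s c n‖ = ((1 + knorm n) ^ 2)⁻¹ * (‖lam s c n‖ * (1 + knorm n) ^ 2) := by
    intro n
    have : (1 + knorm n) ^ 2 ≠ 0 := by have := hk n; positivity
    rw [mul_comm ‖lam s c n‖, inv_mul_cancel_left₀ this]
  rw [Finset.sum_congr rfl fun n _ => e n]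
  refine (Real.sum_mul_le_sqrt_mul_sqrt F _ _).trans ?_
  have A : ∑ n ∈ F, (((1 + knorm n) ^ 2)⁻¹) ^ 2 ≤ ∑' n : Z3, ((1 + knorm n) ^ 4)⁻¹ := by
    have : ∀ n : Z3, (((1 + knorm n) ^ 2)⁻¹) ^ 2 = ((1 + knorm n) ^ 4)⁻¹ := by
      intro n; rw [inv_pow, ← pow_mul]
    simp_rw [this]
    exact summable_weight.sum_le_tsum F fun n _ => by have := hk n; positivity
  have Bd : ∑ n ∈ F, (‖lam s c n‖ * (1 + knorm n) ^ 2) ^ 2 ≤ (4 * hnorm (s + 2) c) ^ 2 := by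
    rw [mul_pow, hnorm_sq]
    refine le_trans ?_ (mul_le_mul_of_nonneg_left
      ((summable_hnorm hc (by linarith : 0 ≤ s + 2)).sum_le_tsum F fun n _ => ?_) (by norm_num))
    · rw [Finset.mul_sum]
      refine Finset.sum_le_sum fun n _ => ?_
      rw [norm_lam, rpow_two_mul']
      have h1 := weight_bound hs n
      have h0 : 0 ≤ knorm n ^ s * (1 + knorm n) ^ 2 := by have := hk n; positivity
      have h2 : (knorm n ^ s * (1 + knorm n) ^ 2) ^ 2 ≤ (4 * knorm n ^ (s + 2)) ^ 2 := by gcongr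
      have h3 : 0 ≤ ‖c n‖ ^ 2 := by positivity
      calc _ = (knorm n ^ s * (1 + knorm n) ^ 2) ^ 2 * ‖c n‖ ^ 2 := by ring
        _ ≤ (4 * knorm n ^ (s + 2)) ^ 2 * ‖c n‖ ^ 2 := mul_le_mul_of_nonneg_right h2 h3
        _ ≤ _ := by nlinarith
    · have := Real.rpow_nonneg (hk n) (2 * (s + 2))
      positivity
  have hh : 0 ≤ hnorm (s + 2) c := Real.sqrt_nonneg _
  calc _ ≤ Real.sqrt (∑' n : Z3, ((1 + knorm n) ^ 4)⁻¹) * (4 * hnorm (s + 2) c) := by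
        refine mul_le_mul (Real.sqrt_le_sqrt A) ?_ (Real.sqrt_nonneg _) (Real.sqrt_nonneg _)
        exact (Real.sqrt_le_sqrt Bd).trans (Real.sqrt_sq (by positivity)).le
    _ = _ := by ring

lemma hnorm_le_V3 (s : ℝ) (b : Fin 3 → Z3 → ℂ) (j : Fin 3) : hnorm s (b j) ≤ hnormV3 s b := by
  refine Real.le_sqrt_of_sq_le ?_
  exact Finset.single_le_sum (f := fun j => hnorm s (b j) ^ 2) (fun _ _ => sq_nonneg _)
    (Finset.mem_univ j)

theorem estimate_part {σ : ℝ} (hσ : 1 ≤ σ) :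
    ∃ C : ℝ, 0 < C ∧ ∀ b : Fin 3 → Z3 → ℂ, SmoothV3 b → ∀ V : Fin 2 → Z3 → ℂ, SmoothV2 V →
      |inner2V (lamV σ V) (commLamV σ b V)| ≤ C * hnormV3 (σ + 2) b * hnormV2 σ V ^ 2 := by
  set A := 4 * Real.sqrt (∑' n : Z3, ((1 + knorm n) ^ 4)⁻¹) with hA
  have hA0 : 0 ≤ A := by positivity
  refine ⟨(σ * 2 ^ (σ - 1)) * (3 * (A + 1)), by positivity, fun b hb V hV => ?_⟩
  have hσ0 : 0 ≤ σ := by linarith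
  have hB0 : 0 ≤ hnormV3 (σ + 2) b := Real.sqrt_nonneg _
  have hB : ∑' m, ∑ j, ‖lam σ (b j) m‖ ≤ 3 * (A + 1) * hnormV3 (σ + 2) b := by
    rw [Summable.tsum_finsetSum fun j _ => ((hb j).2.lam hσ0).summable]
    calc _ ≤ ∑ _j : Fin 3, (A + 1) * hnormV3 (σ + 2) b := by
          refine Finset.sum_le_sum fun j _ => (tsum_lam_le (hb j).2 (by linarith)).trans ?_
          exact mul_le_mul (by linarith) (hnorm_le_V3 _ b j) (Real.sqrt_nonneg _) (by linarith)
      _ = _ := by simp; ring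
  have hV2 : hnormV2 σ V ^ 2 = ∑ i, hnorm σ (V i) ^ 2 :=
    Real.sq_sqrt (Finset.sum_nonneg fun _ _ => sq_nonneg _)
  rw [hV2, Finset.mul_sum]
  refine (Finset.abs_sum_le_sum_abs _ _).trans (Finset.sum_le_sum fun i _ => ?_)
  refine (inner2_comm_bound hσ (fun j => (hb j).2) (hV i).2).trans ?_
  rw [mul_assoc (σ * 2 ^ (σ - 1)), mul_assoc (σ * 2 ^ (σ - 1))]
  refine mul_le_mul_of_nonneg_left ?_ (by positivity)
  exact mul_le_mul hB (tsum_lam_sq_le (hV i).2 hσ0)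
    (tsum_nonneg fun _ => by positivity) (by positivity)

/-- Let `σ > 5/2`. For every smooth divergence-free `b` and every smooth
ℝ²-valued `V` with `𝒫V = V`, `⟨Λ^{2σ}V, 𝒫(b·∇V)⟩ = ⟨Λ^σV, [Λ^σ, b·∇]V⟩`, and consequently
there is `C = C(σ) > 0` with `|⟨Λ^{2σ}V, 𝒫(b·∇V)⟩| ≤ C ‖b‖_{H^{σ+2}} ‖V‖²_{H^σ}`. -/
theorem stmt8 (σ : ℝ) (hσ : 5 / 2 < σ) :
    (∀ b : Fin 3 → Z3 → ℂ, SmoothV3 b → DivFree b →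
      ∀ V : Fin 2 → Z3 → ℂ, SmoothV2 V → hproj V = V →
        inner2V (lamV (2 * σ) V) (hproj (transportV b V)) =
          inner2V (lamV σ V) (commLamV σ b V)) ∧
    ∃ C : ℝ, 0 < C ∧
      ∀ b : Fin 3 → Z3 → ℂ, SmoothV3 b → DivFree b →
        ∀ V : Fin 2 → Z3 → ℂ, SmoothV2 V → hproj V = V →
          |inner2V (lamV (2 * σ) V) (hproj (transportV b V))| ≤
            C * hnormV3 (σ + 2) b * hnormV2 σ V ^ 2 := by
  refine ⟨fun b hb hdiv V hV hVp => identity_part (by linarith) hb hdiv hV hVp, ?_⟩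
  obtain ⟨C, hC, h⟩ := estimate_part (σ := σ) (by linarith)
  refine ⟨C, hC, fun b hb hdiv V hV hVp => ?_⟩
  rw [identity_part (by linarith) hb hdiv hV hVp]
  exact h b hb V hV
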